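/- arXiv:2508.09341 — 2 statements merged into one kernel-verified Lean document; each statement's English description precedes it below -/
import Mathlib

section
/- Suppose n and d are positive integers with n ≥ 3d. Then E^n_d = E^{3d}_d if n and d have the same parity or if n is odd, and E^n_d = 0 otherwise (i.e., when n is even and d is odd). -/
open scoped Classical in
/-- The neighborhood matrix of a finite simple graph over the field `ZMod 2`:
the entry at `(i, j)` is `1` if `i = j` or `i` and `j` are adjacent, and `0` otherwise. -/
noncomputable def nbhdMatrix {V : Type} [Fintype V] [DecidableEq V] (G : SimpleGraph V) :
    Matrix V V (ZMod 2) :=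
  Matrix.of fun i j => if i = j ∨ G.Adj i j then 1 else 0

/-- Lights Out is universally solvable on a finite simple graph iff its neighborhood
matrix over `ZMod 2` is invertible. -/
def UniversallySolvable {V : Type} [Fintype V] [DecidableEq V] (G : SimpleGraph V) : Prop :=
  IsUnit (nbhdMatrix G)


/-- The setoid on graphs on `Fin n` satisfying a property `P`, identifying isomorphic
graphs. Its quotient is the set of isomorphism classes of graphs satisfying `P`. -/
def isoSetoid {n : ℕ} (P : SimpleGraph (Fin n) → Prop) :
    Setoid {G : SimpleGraph (Fin n) // P G} where
  r G H := Nonempty (G.1 ≃g H.1)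
  iseqv := ⟨fun _ => ⟨SimpleGraph.Iso.refl⟩,
            fun h => h.elim fun e => ⟨e.symm⟩,
            fun h₁ h₂ => h₁.elim fun e => h₂.elim fun f => ⟨e.trans f⟩⟩

/-- The excess degree of a graph `Γ` with `n` vertices:
`edeg(Γ) = i - n + ∑_{v ∈ VΓ} deg(v)`, where `i` is the number of isolated vertices. -/
noncomputable def excessDegree {n : ℕ} (G : SimpleGraph (Fin n)) : ℤ :=
  (({v : Fin n | ∀ w, ¬ G.Adj v w} : Set (Fin n)).ncard : ℤ) - (n : ℤ)
    + ∑ v : Fin n, ((G.neighborSet v).ncard : ℤ)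

/-- `E n d`: the number of isomorphism classes of graphs `Γ` with `n` vertices and excess
degree `d` for which Lights Out is universally solvable on the complement `Γᶜ`. -/
noncomputable def numExcess (n d : ℕ) : ℕ :=
  Nat.card (Quotient (isoSetoid fun G : SimpleGraph (Fin n) =>
    excessDegree G = (d : ℤ) ∧ UniversallySolvable Gᶜ))

open Classical in
/-- The sum over `ZMod 2` of the values of `x` at the neighbours of `v`. -/
noncomputable def adjSum {V : Type} [Fintype V] (G : SimpleGraph V) (x : V → ZMod 2) (v : V) :
    ZMod 2 :=
  ∑ w, if G.Adj v w then x w else 0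

/-- The sum of the adjacency matrix and the all-ones matrix has trivial kernel over `ZMod 2`. -/
def ComplSolvable {V : Type} [Fintype V] (G : SimpleGraph V) : Prop :=
  ∀ x : V → ZMod 2, (∀ v, adjSum G x v = ∑ w, x w) → x = 0

/-- The adjacency matrix has trivial kernel over `ZMod 2`. -/
def AdjNonsingular {V : Type} [Fintype V] (G : SimpleGraph V) : Prop :=
  ∀ x : V → ZMod 2, (∀ v, adjSum G x v = 0) → x = 0

/-- The excess degree as a sum of truncated differences, for graphs on an arbitrary type. -/
noncomputable def excess {V : Type} [Fintype V] (G : SimpleGraph V) : ℕ :=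
  ∑ v, ((G.neighborSet v).ncard - 1)

theorem universallySolvable_compl_iff {V : Type} [Fintype V] [DecidableEq V]
    (G : SimpleGraph V) : UniversallySolvable Gᶜ ↔ ComplSolvable G := by
  have key : ∀ (x : V → ZMod 2) (v : V),
      (nbhdMatrix Gᶜ).mulVec x v = (∑ w, x w) - adjSum G x v := by
    intro x v
    simp only [Matrix.mulVec, dotProduct, nbhdMatrix, Matrix.of_apply, adjSum,
      SimpleGraph.compl_adj, ← Finset.sum_sub_distrib]
    refine Finset.sum_congr rfl fun w _ => ?_
    by_cases hvw : v = w
    · subst hvw; simp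
    · by_cases ha : G.Adj v w <;> simp [hvw, ha]
  rw [UniversallySolvable, ← Matrix.mulVec_injective_iff_isUnit]
  change Function.Injective (nbhdMatrix Gᶜ).mulVecLin ↔ _
  rw [injective_iff_map_eq_zero]
  refine forall_congr' fun x => imp_congr_left ?_
  rw [funext_iff]
  refine forall_congr' fun v => ?_
  rw [Matrix.mulVecLin_apply, key, Pi.zero_apply, sub_eq_zero, eq_comm]

theorem adjSum_iso {V W : Type} [Fintype V] [Fintype W] {G : SimpleGraph V} {H : SimpleGraph W}
    (e : G ≃g H) (x : W → ZMod 2) (v : V) : adjSum G (x ∘ e) v = adjSum H x (e v) := by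
  classical
  exact Fintype.sum_equiv e.toEquiv _ _ fun w => if_congr e.map_adj_iff.symm rfl rfl

theorem ComplSolvable.of_iso {V W : Type} [Fintype V] [Fintype W] {G : SimpleGraph V}
    {H : SimpleGraph W} (e : G ≃g H) (hG : ComplSolvable G) : ComplSolvable H := by
  intro x hx
  have h0 : x ∘ e = 0 := by
    refine hG _ fun v => ?_
    rw [adjSum_iso, hx]
    exact (Fintype.sum_equiv e.toEquiv _ _ fun w => rfl).symm
  funext w
  simpa using congrFun h0 (e.symm w)

theorem excess_iso {V W : Type} [Fintype V] [Fintype W] {G : SimpleGraph V}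
    {H : SimpleGraph W} (e : G ≃g H) : excess G = excess H := by
  refine Fintype.sum_equiv e.toEquiv _ _ fun v => ?_
  congr 1
  exact Nat.card_congr (e.mapNeighborSet v)

theorem excessDegree_eq_excess {n : ℕ} (G : SimpleGraph (Fin n)) :
    excessDegree G = excess G := by
  classical
  have hi : (({v : Fin n | ∀ w, ¬ G.Adj v w} : Set (Fin n)).ncard : ℤ)
      = ∑ v : Fin n, if (G.neighborSet v).ncard = 0 then (1 : ℤ) else 0 := by
    rw [Finset.sum_boole, Set.ncard_eq_toFinset_card']
    congr 2
    ext v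
    simp [Set.ncard_eq_zero (Set.toFinite _), Set.eq_empty_iff_forall_notMem]
  have hn : (n : ℤ) = ∑ v : Fin n, (1 : ℤ) := by simp
  unfold excessDegree excess
  rw [hi, Nat.cast_sum]
  conv_lhs => rw [hn]
  rw [← Finset.sum_sub_distrib, ← Finset.sum_add_distrib]
  refine Finset.sum_congr rfl fun v _ => ?_
  split_ifs with h0
  · simp [h0]
  · omega

theorem ncard_neighborSet {n : ℕ} (G : SimpleGraph (Fin n)) [DecidableRel G.Adj] (v : Fin n) :
    (G.neighborSet v).ncard = G.degree v := by
  rw [Set.ncard_eq_toFinset_card', ← SimpleGraph.card_neighborFinset_eq_degree]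
  rfl

/-- If the number of vertices and the excess degree have different parities, there is an
isolated vertex. -/
theorem exists_isolated {n : ℕ} (G : SimpleGraph (Fin n))
    (hodd : Odd (n + excess G)) : ∃ v, ∀ w, ¬ G.Adj v w := by
  classical
  by_contra hno
  have hi : ({v : Fin n | ∀ w, ¬ G.Adj v w} : Set (Fin n)) = ∅ := by
    ext v
    simp only [Set.mem_ofPred_eq, Set.mem_empty_iff_false, iff_false]
    exact fun hv => hno ⟨v, hv⟩
  have h1 := excessDegree_eq_excess G
  unfold excessDegree at h1
  have h2 := G.sum_degrees_eq_twice_card_edges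
  simp only [hi, Set.ncard_empty, ncard_neighborSet, ← Nat.cast_sum, h2] at h1
  obtain ⟨k, hk⟩ := hodd
  push_cast at h1
  omega

/-- A graph with at least `3 d + 2` vertices, excess degree `d` and solvable complement has a
component with exactly two vertices. -/
theorem exists_isolated_edge {n : ℕ} (G : SimpleGraph (Fin n)) (hS : ComplSolvable G)
    (hn : 3 * excess G + 2 ≤ n) :
    ∃ a b, G.Adj a b ∧ (∀ w, G.Adj a w → w = b) ∧ ∀ w, G.Adj b w → w = a := by
  classical
  by_contra hno
  have hleaf : ∀ u v, G.Adj u v → G.degree v = 1 → G.degree u ≠ 1 := by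
    intro u v huv hv hu
    rw [G.degree_eq_one_iff_existsUnique_adj] at hu hv
    exact hno ⟨u, v, huv, fun w hw => hu.unique hw huv, fun w hw => hv.unique hw huv.symm⟩
  have hiso : (∑ v : Fin n, if G.degree v = 0 then 1 else 0) ≤ 1 := by
    rw [← Finset.card_filter, Finset.card_le_one]
    intro a ha b hb
    by_contra hab
    simp only [Finset.mem_filter, Finset.mem_univ, true_and, G.degree_eq_zero_iff_notMem_support,
      SimpleGraph.mem_support, not_exists] at ha hb
    have hx := hS (Pi.single a 1 + Pi.single b 1) fun v => by
      have h1 : ∑ w, (Pi.single a 1 + Pi.single b 1 : Fin n → ZMod 2) w = 0 := by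
        simp only [Pi.add_apply, Finset.sum_add_distrib, Finset.sum_pi_single', Finset.mem_univ,
          if_true]
        decide
      rw [h1]
      refine Finset.sum_eq_zero fun w _ => ?_
      split_ifs with hvw
      · have hwa : w ≠ a := fun h => ha v (h ▸ hvw.symm)
        have hwb : w ≠ b := fun h => hb v (h ▸ hvw.symm)
        simp [hwa, hwb]
      · rfl
    have := congrFun hx a
    simp [hab] at this
  have hL : (∑ v : Fin n, if G.degree v = 1 then 1 else 0)
      ≤ ∑ u : Fin n, if 2 ≤ G.degree u then G.degree u else 0 := by
    have e1 : (∑ v : Fin n, if G.degree v = 1 then 1 else 0)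
        = ∑ v, ∑ u, if G.Adj u v ∧ G.degree v = 1 then 1 else 0 := by
      refine Finset.sum_congr rfl fun v _ => ?_
      split_ifs with hv
      · have hd : G.degree v = ∑ u, if G.Adj v u then 1 else 0 := by
          rw [← Finset.card_filter, ← SimpleGraph.card_neighborFinset_eq_degree]
          congr 1
          ext; simp
        simp only [hv, and_true]
        exact (hv.symm.trans hd).trans (by simp only [G.adj_comm v])
      · simp [hv]
    rw [e1, Finset.sum_comm]
    refine Finset.sum_le_sum fun u _ => ?_
    have hd : (∑ v, if G.Adj u v ∧ G.degree v = 1 then 1 else 0) ≤ G.degree u := by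
      rw [← Finset.card_filter, ← SimpleGraph.card_neighborFinset_eq_degree]
      refine Finset.card_le_card fun v hv => ?_
      simp at hv
      simp [hv.1]
    split_ifs with hu
    · exact hd
    · refine (Finset.sum_eq_zero fun v _ => if_neg ?_).le
      rintro ⟨huv, hv⟩
      have hpos : 0 < G.degree u := (G.degree_pos_iff_exists_adj u).2 ⟨v, huv⟩
      have := hleaf u v huv hv
      omega
  have hcount : n ≤ (∑ v : Fin n, if G.degree v = 0 then 1 else 0) + 3 * excess G := by
    calc n = ∑ v : Fin n, 1 := by simp
      _ ≤ ∑ v : Fin n, ((if G.degree v = 0 then 1 else 0) + (if G.degree v = 1 then 1 else 0)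
            + if 2 ≤ G.degree v then 1 else 0) :=
          Finset.sum_le_sum fun v _ => by split_ifs <;> omega
      _ ≤ (∑ v : Fin n, if G.degree v = 0 then 1 else 0)
            + ∑ v : Fin n, ((if 2 ≤ G.degree v then G.degree v else 0)
              + if 2 ≤ G.degree v then 1 else 0) := by
          simp only [Finset.sum_add_distrib]
          omega
      _ ≤ _ := by
          unfold excess
          simp only [ncard_neighborSet]
          rw [Finset.mul_sum]
          refine Nat.add_le_add_left (Finset.sum_le_sum fun v _ => ?_) _
          split_ifs <;> omega
  omega

/-- An alternating matrix of odd size over `ZMod 2` is singular. -/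
theorem det_eq_zero_of_alternating {V : Type} [Fintype V] [DecidableEq V]
    (M : Matrix V V (ZMod 2)) (hsymm : ∀ i j, M i j = M j i) (hdiag : ∀ i, M i i = 0)
    (hodd : Odd (Fintype.card V)) : M.det = 0 := by
  let f := Fintype.equivFin V
  let B : Matrix V V ℤ := Matrix.of fun i j =>
    if f i < f j then ((M i j).val : ℤ) else -((M i j).val : ℤ)
  have hB : B.transpose = -B := by
    ext i j
    simp only [B, Matrix.transpose_apply, Matrix.neg_apply, Matrix.of_apply, hsymm j i]
    rcases lt_trichotomy (f i) (f j) with h | h | h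
    · simp [h, h.not_gt]
    · obtain rfl := f.injective h
      simp [hdiag]
    · simp [h, h.not_gt]
  have hdet : B.det = 0 := by
    have h1 := B.det_transpose
    rw [hB, Matrix.det_neg, hodd.neg_one_pow] at h1
    omega
  have hM : M = (Int.castRingHom (ZMod 2)).mapMatrix B := by
    ext i j
    simp only [B, RingHom.mapMatrix_apply, Matrix.map_apply, Matrix.of_apply]
    split_ifs
    · simp
    · simp [ZMod.neg_eq_self_mod_two]
  rw [hM, ← RingHom.map_det, hdet, map_zero]

theorem not_adjNonsingular_of_odd {V : Type} [Fintype V] (G : SimpleGraph V)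
    (hodd : Odd (Fintype.card V)) : ¬ AdjNonsingular G := by
  classical
  intro hG
  obtain ⟨x, hx0, hx⟩ := Matrix.exists_mulVec_eq_zero_iff.2
    (det_eq_zero_of_alternating (G.adjMatrix (ZMod 2))
      (fun i j => by simp [SimpleGraph.adjMatrix_apply, G.adj_comm]) (by simp) hodd)
  refine hx0 (hG x fun v => ?_)
  have := congrFun hx v
  simpa [Matrix.mulVec, dotProduct, SimpleGraph.adjMatrix_apply, adjSum] using this

theorem sum_mul_adjSum_comm {V : Type} [Fintype V] (G : SimpleGraph V) (x y : V → ZMod 2) :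
    ∑ v, x v * adjSum G y v = ∑ v, y v * adjSum G x v := by
  simp only [adjSum, Finset.mul_sum]
  rw [Finset.sum_comm]
  refine Finset.sum_congr rfl fun v _ => Finset.sum_congr rfl fun w _ => ?_
  rw [G.adj_comm]
  split_ifs <;> ring

theorem sum_mul_adjSum_self {V : Type} [Fintype V] (G : SimpleGraph V) (x : V → ZMod 2) :
    ∑ v, x v * adjSum G x v = 0 := by
  classical
  simp only [adjSum, Finset.mul_sum]
  rw [← Finset.sum_product']
  refine Finset.sum_involution (fun p _ => p.swap) ?_ ?_ (by simp) (by simp)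
  · rintro ⟨v, w⟩ -
    simp only [Prod.swap, G.adj_comm w v]
    rw [← CharTwo.add_self_eq_zero (x v * if G.Adj v w then x w else 0)]
    split_ifs <;> ring
  · rintro ⟨v, w⟩ - hne heq
    simp only [Prod.swap, Prod.mk.injEq] at heq
    simp [heq.1] at hne

theorem AdjNonsingular.complSolvable {V : Type} [Fintype V] {G : SimpleGraph V}
    (hG : AdjNonsingular G) : ComplSolvable G := by
  intro x hx
  have h1 := sum_mul_adjSum_self G x
  simp only [hx, ← Finset.sum_mul, mul_self_eq_zero] at h1
  exact hG x fun v => (hx v).trans h1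

theorem ComplSolvable.adjNonsingular {V : Type} [Fintype V] {G : SimpleGraph V}
    (hG : ComplSolvable G) (heven : Even (Fintype.card V)) : AdjNonsingular G := by
  classical
  obtain ⟨z, hz0, hz⟩ := Matrix.exists_mulVec_eq_zero_iff.2
    (det_eq_zero_of_alternating
      (Matrix.fromBlocks (G.adjMatrix (ZMod 2)) (Matrix.of fun _ _ => 1)
        (Matrix.of fun _ _ => 1) 0 :
        Matrix (V ⊕ Unit) (V ⊕ Unit) (ZMod 2))
      (by rintro (i | i) (j | j) <;> simp [SimpleGraph.adjMatrix_apply, G.adj_comm])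
      (by rintro (i | i) <;> simp)
      (by simpa using heven.add_one))
  have hl : ∀ v, adjSum G (z ∘ Sum.inl) v = z (Sum.inr ()) := by
    intro v
    have := congrFun hz (Sum.inl v)
    simp only [Matrix.mulVec, dotProduct, Fintype.sum_sum_type, Matrix.fromBlocks_apply₁₁,
      Matrix.fromBlocks_apply₁₂, Matrix.of_apply, SimpleGraph.adjMatrix_apply, ite_mul, one_mul, zero_mul,
      Finset.univ_unique, Finset.sum_singleton, Pi.zero_apply] at this
    exact CharTwo.add_eq_zero.1 this
  have hr : ∑ v, z (Sum.inl v) = 0 := by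
    simpa [Matrix.mulVec, dotProduct] using congrFun hz (Sum.inr ())
  have hzr : z (Sum.inr ()) ≠ 0 := by
    intro h0
    have := hG (z ∘ Sum.inl) fun v => by rw [hl, h0]; exact hr.symm
    refine hz0 (funext ?_)
    rintro (v | v)
    · exact congrFun this v
    · exact h0
  intro y hy
  refine hG y fun v => ?_
  have h1 := sum_mul_adjSum_comm G y (z ∘ Sum.inl)
  simp only [hl, hy, mul_zero, Finset.sum_const_zero, ← Finset.sum_mul] at h1
  rw [hy, (mul_eq_zero.1 h1).resolve_right hzr]

theorem adjSum_sum_inl {V W : Type} [Fintype V] [Fintype W] (G : SimpleGraph V)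
    (H : SimpleGraph W) (x : V ⊕ W → ZMod 2) (v : V) :
    adjSum (G ⊕g H) x (Sum.inl v) = adjSum G (x ∘ Sum.inl) v := by
  classical
  simp [adjSum]

theorem adjSum_sum_inr {V W : Type} [Fintype V] [Fintype W] (G : SimpleGraph V)
    (H : SimpleGraph W) (x : V ⊕ W → ZMod 2) (w : W) :
    adjSum (G ⊕g H) x (Sum.inr w) = adjSum H (x ∘ Sum.inr) w := by
  classical
  simp [adjSum]

theorem complSolvable_sum_vertex {V : Type} [Fintype V] (G : SimpleGraph V) :
    ComplSolvable (G ⊕g (⊤ : SimpleGraph (Fin 1))) ↔ AdjNonsingular G := by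
  constructor
  · intro hG x hx
    have := hG (Sum.elim x fun _ => ∑ v, x v) (by
      have hs : ∑ w, Sum.elim x (fun _ : Fin 1 => ∑ v, x v) w = 0 := by
        simp [CharTwo.add_self_eq_zero]
      rw [hs]
      rintro (v | v)
      · rw [adjSum_sum_inl]; exact hx v
      · rw [adjSum_sum_inr]; simp [adjSum, Subsingleton.elim v 0])
    funext v
    simpa using congrFun this (Sum.inl v)
  · intro hG x hx
    have hs : ∑ w, x w = 0 := by
      rw [← hx (Sum.inr 0), adjSum_sum_inr]; simp [adjSum]
    have hl := hG (x ∘ Sum.inl) fun v => by rw [← adjSum_sum_inl G ⊤, hx, hs]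
    have hl' : ∀ v, x (Sum.inl v) = 0 := congrFun hl
    funext v
    rcases v with v | v
    · exact hl' v
    · simpa [hl', Subsingleton.elim v 0] using hs

theorem complSolvable_sum_edge {V : Type} [Fintype V] (G : SimpleGraph V) :
    ComplSolvable (G ⊕g (⊤ : SimpleGraph (Fin 2))) ↔ ComplSolvable G := by
  constructor
  · intro hG x hx
    have := hG (Sum.elim x fun _ => ∑ v, x v) (by
      have hs : ∑ w, Sum.elim x (fun _ : Fin 2 => ∑ v, x v) w = ∑ v, x v := by
        simp [CharTwo.two_eq_zero]
      rw [hs]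
      rintro (v | v)
      · rw [adjSum_sum_inl]; exact hx v
      · rw [adjSum_sum_inr]; fin_cases v <;> simp [adjSum, Fin.sum_univ_two])
    funext v
    simpa using congrFun this (Sum.inl v)
  · intro hG x hx
    have h0 : x (Sum.inr 1) = ∑ w, x w := by
      rw [← hx (Sum.inr 0), adjSum_sum_inr]; simp [adjSum, Fin.sum_univ_two]
    have h1 : x (Sum.inr 0) = ∑ w, x w := by
      rw [← hx (Sum.inr 1), adjSum_sum_inr]; simp [adjSum, Fin.sum_univ_two]
    have hs : ∑ w, x w = ∑ v, x (Sum.inl v) := by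
      conv_lhs => rw [Fintype.sum_sum_type, Fin.sum_univ_two, h0, h1]
      rw [CharTwo.add_self_eq_zero, add_zero]
    have hl := hG (x ∘ Sum.inl) fun v => by rw [← adjSum_sum_inl G ⊤, hx, hs]; rfl
    have hl' : ∀ v, x (Sum.inl v) = 0 := congrFun hl
    have hs0 : ∑ w, x w = 0 := by rw [hs]; simp [hl']
    funext v
    rcases v with v | v
    · exact hl' v
    · fin_cases v
      · exact h1.trans hs0
      · exact h0.trans hs0

theorem excess_sum_complete {V : Type} [Fintype V] (G : SimpleGraph V) {k : ℕ} (hk : k ≤ 2) :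
    excess (G ⊕g (⊤ : SimpleGraph (Fin k))) = excess G := by
  unfold excess
  rw [Fintype.sum_sum_type]
  have hl : ∀ v, ((G ⊕g (⊤ : SimpleGraph (Fin k))).neighborSet (Sum.inl v)).ncard
      = (G.neighborSet v).ncard := by
    intro v
    rw [← Set.ncard_image_of_injective (G.neighborSet v) (Sum.inl_injective (β := Fin k))]
    congr 1
    ext (w | w) <;> simp
  have hr : ∀ i, ((G ⊕g (⊤ : SimpleGraph (Fin k))).neighborSet (Sum.inr i)).ncard = k - 1 := by
    intro i
    have : (G ⊕g (⊤ : SimpleGraph (Fin k))).neighborSet (Sum.inr i)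
        = Sum.inr '' ({i}ᶜ : Set (Fin k)) := by
      ext (w | w) <;> simp [eq_comm]
    rw [this, Set.ncard_image_of_injective _ Sum.inr_injective, Set.ncard_compl]
    simp
  simp only [hl, hr, Nat.add_eq_left, Finset.sum_const]
  simp
  omega

/-- Complete summands can be cancelled from disjoint sums of graphs. -/
theorem nonempty_iso_of_sum_complete {n k : ℕ} {G H : SimpleGraph (Fin n)}
    (e : (G ⊕g (⊤ : SimpleGraph (Fin k))) ≃g (H ⊕g (⊤ : SimpleGraph (Fin k)))) :
    Nonempty (G ≃g H) := by
  have hex : ∀ g, ∃ h, e (Sum.inl g) = Sum.inl h ∨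
      ∃ i, e (Sum.inl g) = Sum.inr i ∧ e (Sum.inr i) = Sum.inl h := by
    intro g
    rcases hg : e (Sum.inl g) with h | i
    · exact ⟨h, Or.inl rfl⟩
    · rcases hi : e (Sum.inr i) with h | j
      · exact ⟨h, Or.inr ⟨i, rfl, hi⟩⟩
      · exfalso
        by_cases hij : i = j
        · subst hij
          simpa using e.injective (hg.trans hi.symm)
        · have : (H ⊕g (⊤ : SimpleGraph (Fin k))).Adj (e (Sum.inl g)) (e (Sum.inr i)) := by
            rw [hg, hi]; simpa using hij
          rw [e.map_adj_iff] at this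
          simp at this
  choose φ hφ using hex
  have hinj : Function.Injective φ := by
    intro g g' hgg
    have h1 := hφ g
    have h2 := hφ g'
    rw [← hgg] at h2
    rcases h1 with h1 | ⟨i, h1, h1'⟩ <;> rcases h2 with h2 | ⟨j, h2, h2'⟩
    · simpa using e.injective (h1.trans h2.symm)
    · simpa using e.injective (h1.trans h2'.symm)
    · simpa using e.injective (h1'.trans h2.symm)
    · have hij : i = j := by simpa using e.injective (h1'.trans h2'.symm)
      subst hij
      simpa using e.injective (h1.trans h2.symm)
  have hadj : ∀ g g', H.Adj (φ g) (φ g') ↔ G.Adj g g' := by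
    intro g g'
    have hll := e.map_adj_iff (v := Sum.inl g) (w := Sum.inl g')
    rcases hφ g with h1 | ⟨i, h1, h1'⟩ <;> rcases hφ g' with h2 | ⟨j, h2, h2'⟩
    · simpa [h1, h2] using hll
    · have := e.map_adj_iff (v := Sum.inl g) (w := Sum.inr j)
      simp [h1, h2, h2'] at hll this
      tauto
    · have := e.map_adj_iff (v := Sum.inr i) (w := Sum.inl g')
      simp [h1, h1', h2] at hll this
      tauto
    · have := e.map_adj_iff (v := Sum.inr i) (w := Sum.inr j)
      simp [h1, h1', h2, h2'] at hll this
      tauto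
  exact ⟨⟨Equiv.ofBijective φ (Finite.injective_iff_bijective.1 hinj), fun {a b} => hadj a b⟩⟩

/-- A complete component splits off as a direct summand. -/
theorem exists_iso_sum_complete {n k : ℕ} (G : SimpleGraph (Fin (n + k))) (c : Fin k → Fin (n + k))
    (hc : Function.Injective c) (hadj : ∀ i w, G.Adj (c i) w ↔ ∃ j, j ≠ i ∧ w = c j) :
    ∃ H : SimpleGraph (Fin n), Nonempty ((H ⊕g (⊤ : SimpleGraph (Fin k))) ≃g G) := by
  classical
  have hcard : Fintype.card (Fin n) = Fintype.card ((Set.range c)ᶜ : Set (Fin (n + k))) := by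
    rw [Fintype.card_compl_set, Set.card_range_of_injective hc]
    simp
  let E : Fin n ⊕ Fin k ≃ Fin (n + k) :=
    (Equiv.sumCongr (Fintype.equivOfCardEq hcard) (Equiv.ofInjective c hc)).trans
      ((Equiv.sumComm _ _).trans (Equiv.Set.sumCompl (Set.range c)))
  have hE : ∀ i, E (Sum.inr i) = c i := fun i => by simp [E]
  have hE' : ∀ v i, E (Sum.inl v) ≠ c i := by
    intro v i h
    rw [← hE] at h
    simpa using E.injective h
  refine ⟨G.comap (E ∘ Sum.inl), ⟨⟨E, ?_⟩⟩⟩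
  rintro (v | i) (w | j)
  · simp
  · simp only [hE, G.adj_comm, hadj]
    simp [hE']
  · simp only [hE, hadj]
    simp [hE']
  · simp only [hE, hadj, hc.eq_iff]
    simp [eq_comm]

/-- Adding a complete component is a bijection on isomorphism classes as soon as it is compatible
with the properties defining the classes. -/
theorem card_quotient_eq_of_sum_complete {n k : ℕ} (P : SimpleGraph (Fin n) → Prop)
    (Q : SimpleGraph (Fin (n + k)) → Prop)
    (hPQ : ∀ (G : SimpleGraph (Fin n)) (G' : SimpleGraph (Fin (n + k))),
      ((G ⊕g (⊤ : SimpleGraph (Fin k))) ≃g G') → (P G ↔ Q G'))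
    (hsurj : ∀ G', Q G' → ∃ G : SimpleGraph (Fin n),
      Nonempty ((G ⊕g (⊤ : SimpleGraph (Fin k))) ≃g G')) :
    Nat.card (Quotient (isoSetoid P)) = Nat.card (Quotient (isoSetoid Q)) := by
  let F : SimpleGraph (Fin n) → SimpleGraph (Fin (n + k)) := fun G =>
    (G ⊕g (⊤ : SimpleGraph (Fin k))).map finSumFinEquiv.toEmbedding
  let hF : ∀ G, (G ⊕g (⊤ : SimpleGraph (Fin k))) ≃g F G := fun G =>
    SimpleGraph.Iso.map finSumFinEquiv _
  let f : {G // P G} → {G // Q G} := fun G => ⟨F G.1, (hPQ _ _ (hF G.1)).1 G.2⟩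
  have hf : ∀ G H : {G // P G}, (isoSetoid P).r G H → (isoSetoid Q).r (f G) (f H) := by
    rintro G H ⟨e⟩
    exact ⟨(hF G.1).symm.trans ((SimpleGraph.Iso.sumCongr e SimpleGraph.Iso.refl).trans (hF H.1))⟩
  refine Nat.card_eq_of_bijective (Quotient.map f hf) ⟨?_, ?_⟩
  · rintro ⟨G⟩ ⟨H⟩ hGH
    obtain ⟨e⟩ := Quotient.exact hGH
    exact Quotient.sound (nonempty_iso_of_sum_complete ((hF G.1).trans (e.trans (hF H.1).symm)))
  · rintro ⟨G', hG'⟩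
    obtain ⟨G, ⟨e⟩⟩ := hsurj G' hG'
    exact ⟨Quotient.mk _ ⟨G, (hPQ _ _ e).2 hG'⟩, Quotient.sound ⟨(hF G).symm.trans e⟩⟩

theorem excessDegree_and_universallySolvable_iff {n : ℕ} (G : SimpleGraph (Fin n)) (d : ℕ) :
    (excessDegree G = (d : ℤ) ∧ UniversallySolvable Gᶜ) ↔ excess G = d ∧ ComplSolvable G := by
  rw [excessDegree_eq_excess, universallySolvable_compl_iff, Nat.cast_inj]

theorem ComplSolvable.iff_of_iso {V W : Type} [Fintype V] [Fintype W] {G : SimpleGraph V}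
    {H : SimpleGraph W} (e : G ≃g H) : ComplSolvable G ↔ ComplSolvable H :=
  ⟨.of_iso e, .of_iso e.symm⟩

theorem numExcess_add_two {n d : ℕ} (h : 3 * d ≤ n) : numExcess n d = numExcess (n + 2) d := by
  refine card_quotient_eq_of_sum_complete _ _ (fun G G' e => ?_) fun G' hG' => ?_
  · rw [excessDegree_and_universallySolvable_iff, excessDegree_and_universallySolvable_iff,
      ← excess_iso e, ← ComplSolvable.iff_of_iso e, excess_sum_complete G le_rfl,
      complSolvable_sum_edge]
  · rw [excessDegree_and_universallySolvable_iff] at hG'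
    obtain ⟨a, b, hab, ha, hb⟩ := exists_isolated_edge G' hG'.2 (by omega)
    refine exists_iso_sum_complete G' ![a, b] ?_ ?_
    · intro i j hij
      fin_cases i <;> fin_cases j <;> simp_all [hab.ne, hab.ne']
    · have ha' : ∀ w, G'.Adj a w ↔ w = b := fun w => ⟨ha w, fun h => h ▸ hab⟩
      have hb' : ∀ w, G'.Adj b w ↔ w = a := fun w => ⟨hb w, fun h => h ▸ hab.symm⟩
      intro i w
      fin_cases i <;> simp [Fin.exists_fin_two, ha', hb']

theorem exists_iso_sum_vertex {n : ℕ} (G : SimpleGraph (Fin (n + 1)))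
    (hodd : Odd (n + 1 + excess G)) :
    ∃ H : SimpleGraph (Fin n), Nonempty ((H ⊕g (⊤ : SimpleGraph (Fin 1))) ≃g G) := by
  obtain ⟨v, hv⟩ := exists_isolated G hodd
  refine exists_iso_sum_complete G (fun _ => v) (Function.injective_of_subsingleton _) fun i w => ?_
  simp [hv, Subsingleton.elim _ i]

theorem numExcess_add_one {n d : ℕ} (hn : Even n) (hd : Even d) :
    numExcess n d = numExcess (n + 1) d := by
  refine card_quotient_eq_of_sum_complete _ _ (fun G G' e => ?_) fun G' hG' => ?_
  · rw [excessDegree_and_universallySolvable_iff, excessDegree_and_universallySolvable_iff,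
      ← excess_iso e, ← ComplSolvable.iff_of_iso e, excess_sum_complete G one_le_two,
      complSolvable_sum_vertex]
    exact and_congr_right fun _ =>
      ⟨fun hG => hG.adjNonsingular (by simpa using hn), AdjNonsingular.complSolvable⟩
  · rw [excessDegree_and_universallySolvable_iff] at hG'
    exact exists_iso_sum_vertex G' (by rw [hG'.1]; exact hn.add_one.add_even hd)

theorem numExcess_eq_zero {n d : ℕ} (hn : Odd n) (hd : Odd d) : numExcess (n + 1) d = 0 := by
  have : IsEmpty {G : SimpleGraph (Fin (n + 1)) //
      excessDegree G = (d : ℤ) ∧ UniversallySolvable Gᶜ} := by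
    refine ⟨fun ⟨G, hG⟩ => ?_⟩
    rw [excessDegree_and_universallySolvable_iff] at hG
    obtain ⟨H, ⟨e⟩⟩ := exists_iso_sum_vertex G (by rw [hG.1]; exact hn.add_one.add_odd hd)
    rw [← ComplSolvable.iff_of_iso e, complSolvable_sum_vertex] at hG
    exact not_adjNonsingular_of_odd H (by simpa using hn) hG.2
  unfold numExcess
  exact Nat.card_of_isEmpty

theorem numExcess_add_two_mul {n d : ℕ} (h : 3 * d ≤ n) (k : ℕ) :
    numExcess (n + 2 * k) d = numExcess n d := by
  induction k with
  | zero => rfl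
  | succ k ih => rw [← ih, Nat.mul_succ, ← add_assoc, ← numExcess_add_two (by omega)]

/-- For positive integers `n ≥ 3d`: if `n` and `d` have the same parity or `n` is odd,
then `E^n_d = E^{3d}_d`; otherwise (when `n` is even and `d` is odd), `E^n_d = 0`. -/
theorem numExcess_stabilizes (n d : ℕ) (hn : 0 < n) (hd : 0 < d) (h : 3 * d ≤ n) :
    (((Even n ↔ Even d) ∨ Odd n) → numExcess n d = numExcess (3 * d) d) ∧
    (¬ ((Even n ↔ Even d) ∨ Odd n) → numExcess n d = 0) := by
  obtain ⟨m, rfl⟩ := Nat.exists_eq_add_of_le h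
  constructor
  · intro hpar
    rcases Nat.even_or_odd' m with ⟨k, rfl | rfl⟩
    · exact numExcess_add_two_mul le_rfl k
    · have hde : Even d := by
        by_contra hne
        rw [Nat.not_even_iff_odd] at hne
        have : Even (3 * d + (2 * k + 1)) := by
          rw [Nat.odd_iff] at hne
          rw [Nat.even_iff]
          omega
        have h1 := Nat.not_odd_iff_even.2 this
        have h2 := Nat.not_even_iff_odd.2 hne
        tauto
      rw [numExcess_add_one (hde.mul_left 3) hde,
        ← numExcess_add_two_mul (n := 3 * d + 1) (by omega) k]
      congr 1
      omega
  · intro hpar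
    push Not at hpar
    obtain ⟨hpar, he⟩ := hpar
    rw [Nat.not_odd_iff_even] at he
    have hdo : Odd d := by
      rw [← Nat.not_even_iff_odd]
      tauto
    obtain ⟨N, hN⟩ := Nat.exists_eq_add_of_lt hn
    rw [zero_add] at hN
    rw [hN] at he ⊢
    exact numExcess_eq_zero (by rw [← Nat.not_even_iff_odd]; rwa [Nat.even_add_one] at he) hdo
end

section
/- Fix a positive integer m and let k be any integer with 0 ≤ k < m. Then the ratio G_{n, ⌊n/2⌋ + k + 1} / G_{n, ⌊n/2⌋ + k} tends to infinity as n tends to infinity, where G_{n,e} denotes the number of isomorphism classes of simple graphs with n vertices and e edges. -/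
/-- `G_{n,e}`: the number of isomorphism classes of simple graphs with `n` vertices and
exactly `e` edges. -/
noncomputable def numGraphs (n e : ℕ) : ℕ :=
  Nat.card (Quotient (isoSetoid fun G : SimpleGraph (Fin n) => G.edgeSet.ncard = e))

open Finset Equiv

section InvariantSubsets

variable {α : Type*} [DecidableEq α]

/-- The subsets of `U` of cardinality `e` which are invariant under the permutation `σ`. -/
def invariantSubsets [Fintype α] (σ : Perm α) (U : Finset α) (e : ℕ) : Finset (Finset α) :=
  (U.powersetCard e).filter fun S => ∀ x, σ x ∈ S ↔ x ∈ S

/-- The points of `U` fixed by the permutation `σ`. -/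
def fixedPoints (σ : Perm α) (U : Finset α) : Finset α :=
  U.filter fun x => σ x = x

lemma mem_invariantSubsets [Fintype α] {σ : Perm α} {U S : Finset α} {e : ℕ} :
    S ∈ invariantSubsets σ U e ↔ (S ⊆ U ∧ #S = e) ∧ ∀ x, σ x ∈ S ↔ x ∈ S := by
  simp [invariantSubsets]

lemma mem_fixedPoints {σ : Perm α} {U : Finset α} {x : α} :
    x ∈ fixedPoints σ U ↔ x ∈ U ∧ σ x = x := by
  simp [fixedPoints]

/-- Adding a fixed point to an invariant subset gives an invariant subset. -/
lemma insert_mem_invariantSubsets [Fintype α] {σ : Perm α} {U S : Finset α} {e : ℕ} {p : α}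
    (hS : S ∈ invariantSubsets σ U e) (hp : p ∈ fixedPoints σ U) (hpS : p ∉ S) :
    insert p S ∈ invariantSubsets σ U (e + 1) := by
  rw [mem_invariantSubsets] at hS ⊢
  rw [mem_fixedPoints] at hp
  refine ⟨⟨insert_subset hp.1 hS.1.1, by rw [card_insert_of_notMem hpS, hS.1.2]⟩, fun x => ?_⟩
  rw [mem_insert, mem_insert, hS.2]
  have : σ x = p ↔ x = p := by
    conv_lhs => rw [← hp.2]
    exact σ.injective.eq_iff
  rw [this]

/-- Double counting of the pairs formed by an invariant subset and a fixed point outside it. -/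
lemma card_fixedPoints_sub_mul_card_invariantSubsets_le [Fintype α] (σ : Perm α) (U : Finset α) (e : ℕ) :
    (#(fixedPoints σ U) - e) * #(invariantSubsets σ U e) ≤
      (e + 1) * #(invariantSubsets σ U (e + 1)) := by
  have h₁ : (#(fixedPoints σ U) - e) * #(invariantSubsets σ U e) ≤
      #((invariantSubsets σ U e).sigma fun S => fixedPoints σ U \ S) := by
    rw [card_sigma, mul_comm, ← smul_eq_mul, ← sum_const]
    refine sum_le_sum fun S hS => ?_
    rw [← (mem_invariantSubsets.1 hS).1.2]
    exact le_card_sdiff _ _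
  have h₂ : #((invariantSubsets σ U (e + 1)).sigma fun T => T) =
      (e + 1) * #(invariantSubsets σ U (e + 1)) := by
    rw [card_sigma, sum_congr rfl fun T hT => (mem_invariantSubsets.1 hT).1.2]
    simp [mul_comm]
  rw [← h₂]
  refine h₁.trans (card_le_card_of_injOn (fun q => ⟨insert q.2 q.1, q.2⟩) ?_ ?_)
  · rintro ⟨S, p⟩ h
    simp only [mem_coe, mem_sigma, mem_sdiff] at h ⊢
    exact ⟨insert_mem_invariantSubsets h.1 h.2.1 h.2.2, mem_insert_self _ _⟩
  · rintro ⟨S, p⟩ h ⟨S', p'⟩ h' heq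
    simp only [mem_coe, mem_sigma, mem_sdiff] at h h'
    simp only [Sigma.mk.injEq, heq_eq_eq] at heq
    obtain ⟨heq, rfl⟩ := heq
    have : S = S' := by
      rw [← erase_insert h.2.2, heq, erase_insert h'.2.2]
    rw [this]

lemma Equiv.Perm.SameCycle.mem_iff_of_invariant {α : Type*} [Finite α] {σ : Perm α} {S : Finset α} {x y : α}
    (h : σ.SameCycle x y) (hS : ∀ x, σ x ∈ S ↔ x ∈ S) : x ∈ S ↔ y ∈ S := by
  obtain ⟨i, rfl⟩ := h.exists_nat_pow_eq
  induction i with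
  | zero => simp
  | succ i ih =>
    rw [pow_succ', Perm.mul_apply, hS]
    exact ih ⟨i, by simp⟩

/-- An invariant subset is determined by its fixed points and by a choice of representatives of
its nontrivial cycles, of which there are at most half as many as elements. -/
lemma card_invariantSubsets_le [Fintype α] (σ : Perm α) (U : Finset α) (e : ℕ) :
    #(invariantSubsets σ U e) ≤
      2 ^ #(fixedPoints σ U) * #(U.powerset.filter fun R => #R ≤ e / 2) := by
  classical
  let rep : α → α := fun x => (Quotient.mk (Perm.SameCycle.setoid σ) x).out
  have rep_same (x : α) : σ.SameCycle (rep x) x :=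
    Quotient.exact (s := Perm.SameCycle.setoid σ) (Quotient.out_eq _)
  have rep_apply (x : α) : rep (σ x) = rep x :=
    congrArg Quotient.out (Quotient.sound (s := Perm.SameCycle.setoid σ)
      (Perm.sameCycle_apply_left.2 (Perm.SameCycle.refl σ x)))
  rw [← card_powerset, ← card_product]
  refine card_le_card_of_injOn
    (fun S => (S.filter fun x => σ x = x, (S.filter fun x => σ x ≠ x).image rep)) ?_ ?_
  · intro S hS
    obtain ⟨⟨hSU, hSe⟩, hinv⟩ := mem_invariantSubsets.1 hS
    simp only [mem_coe, mem_product, mem_powerset, mem_filter]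
    refine ⟨fun x hx => ?_, fun y hy => ?_, ?_⟩
    · rw [mem_filter] at hx
      exact mem_fixedPoints.2 ⟨hSU hx.1, hx.2⟩
    · obtain ⟨x, hx, rfl⟩ := mem_image.1 hy
      exact hSU (((rep_same x).mem_iff_of_invariant hinv).2 (mem_filter.1 hx).1)
    · have h2 : 2 * #((S.filter fun x => σ x ≠ x).image rep) ≤ #(S.filter fun x => σ x ≠ x) := by
        refine mul_card_image_le_card _ 2 fun b hb => ?_
        obtain ⟨x, hx, rfl⟩ := mem_image.1 hb
        rw [mem_filter] at hx
        refine one_lt_card.2 ⟨x, ?_, σ x, ?_, hx.2.symm⟩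
        · simp [hx.1, hx.2]
        · simp [hinv, hx.1, hx.2, rep_apply]
      have := card_filter_le S fun x => σ x ≠ x
      omega
  · have key : ∀ S S' : Finset α, (∀ x, σ x ∈ S' ↔ x ∈ S') →
        S.filter (fun x => σ x = x) = S'.filter (fun x => σ x = x) →
        (S.filter fun x => σ x ≠ x).image rep = (S'.filter fun x => σ x ≠ x).image rep →
        S ⊆ S' := by
      intro S S' hinv h₁ h₂ x hx
      by_cases hfix : σ x = x
      · have : x ∈ S.filter (fun x => σ x = x) := mem_filter.2 ⟨hx, hfix⟩
        rw [h₁] at this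
        exact (mem_filter.1 this).1
      · have : rep x ∈ (S.filter fun x => σ x ≠ x).image rep :=
          mem_image_of_mem _ (mem_filter.2 ⟨hx, hfix⟩)
        rw [h₂] at this
        obtain ⟨z, hz, hzx⟩ := mem_image.1 this
        have hzx' : σ.SameCycle z x := (rep_same z).symm.trans (hzx ▸ rep_same x)
        exact (hzx'.mem_iff_of_invariant hinv).1 (mem_filter.1 hz).1
    intro S hS S' hS' heq
    obtain ⟨h₁, h₂⟩ := Prod.mk.inj heq
    exact (key S S' (mem_invariantSubsets.1 hS').2 h₁ h₂).antisymm
      (key S' S (mem_invariantSubsets.1 hS).2 h₁.symm h₂.symm)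

/-- A bound for the number of small subsets of a set with at most `n ^ 2` elements. -/
lemma card_filter_card_le {α : Type*} (U : Finset α) {n : ℕ} (hn : 0 < n) (hU : #U ≤ n ^ 2) (r : ℕ) :
    #(U.powerset.filter fun R => #R ≤ r) ≤ n ^ r * 3 ^ n := by
  have h₁ : #(U.powerset.filter fun R => #R ≤ r) * n ^ #U ≤ n ^ r * (1 + n) ^ #U := by
    rw [← sum_pow_mul_eq_add_pow 1 n U, mul_sum, ← smul_eq_mul, ← sum_const]
    refine (sum_le_sum fun R hR => ?_).trans
      (sum_le_sum_of_subset (filter_subset _ _))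
    rw [mem_filter, mem_powerset] at hR
    rw [one_pow, one_mul, ← pow_add]
    exact Nat.pow_le_pow_right hn (by omega)
  have hn' : (0 : ℝ) < n := by exact_mod_cast hn
  have h₂ : ((1 : ℝ) + n) ^ #U ≤ 3 ^ n * n ^ #U := by
    have : (1 : ℝ) + n = (1 / n + 1) * n := by field_simp
    rw [this, mul_pow]
    gcongr
    calc (1 / (n : ℝ) + 1) ^ #U ≤ (1 / (n : ℝ) + 1) ^ (n ^ 2) :=
          pow_le_pow_right₀ (by simp) hU
      _ ≤ Real.exp (1 / n) ^ (n ^ 2) := by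
          gcongr
          exact Real.add_one_le_exp _
      _ = Real.exp 1 ^ n := by
          rw [← Real.exp_nat_mul, ← Real.exp_nat_mul]
          congr 1
          push_cast
          field_simp
      _ ≤ 3 ^ n := by
          gcongr
          exact Real.exp_one_lt_three.le
  have h₂' : (1 + n) ^ #U ≤ 3 ^ n * n ^ #U := by exact_mod_cast h₂
  refine Nat.le_of_mul_le_mul_right (h₁.trans ?_) (pow_pos hn #U)
  calc n ^ r * (1 + n) ^ #U ≤ n ^ r * (3 ^ n * n ^ #U) := by gcongr
    _ = n ^ r * 3 ^ n * n ^ #U := by ring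

/-- Either the permutation has many fixed points and there are many more invariant subsets of
cardinality `e + 1` than of cardinality `e`, or there are few invariant subsets. -/
lemma mul_card_invariantSubsets_le [Fintype α] (σ : Perm α) (U : Finset α) {n : ℕ} (hn : 0 < n)
    (hU : #U ≤ n ^ 2) (M e : ℕ) :
    M * #(invariantSubsets σ U e) ≤ #(invariantSubsets σ U (e + 1)) +
      M * (2 ^ ((M + 1) * (e + 1)) * (n ^ (e / 2) * 3 ^ n)) := by
  rcases le_total ((M + 1) * (e + 1)) #(fixedPoints σ U) with h | h
  · refine le_add_right (Nat.le_of_mul_le_mul_left ?_ e.succ_pos)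
    refine le_trans ?_ (card_fixedPoints_sub_mul_card_invariantSubsets_le σ U e)
    rw [← mul_assoc]
    gcongr
    have : (M + 1) * (e + 1) = (e + 1) * M + e + 1 := by ring
    rw [Nat.succ_eq_add_one]
    omega
  · refine le_add_left ?_
    gcongr
    refine (card_invariantSubsets_le σ U e).trans ?_
    gcongr
    · norm_num
    · exact card_filter_card_le U hn hU _

end InvariantSubsets

section Burnside

variable {n : ℕ}

/-- The permutation of unordered pairs induced by a permutation. -/
def sym2Perm (π : Perm (Fin n)) : Perm (Sym2 (Fin n)) where
  toFun := Sym2.map π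
  invFun := Sym2.map π.symm
  left_inv z := by simp [Sym2.map_map]
  right_inv z := by simp [Sym2.map_map]

/-- The unordered pairs of distinct elements of `Fin n`. -/
def properPairs (n : ℕ) : Finset (Sym2 (Fin n)) :=
  univ.filter fun z => ¬ z.IsDiag

lemma card_properPairs_le (n : ℕ) : #(properPairs n) ≤ n ^ 2 := by
  have : properPairs n = (⊤ : SimpleGraph (Fin n)).edgeFinset := by
    ext z
    simp [properPairs, Sym2.mem_diagSet]
  rw [this, SimpleGraph.card_edgeFinset_top_eq_card_choose_two, Fintype.card_fin]
  exact Nat.choose_le_pow _ _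

/-- The permutations of the vertices act on the graphs with `e` edges. -/
instance graphAction (n e : ℕ) :
    MulAction (Perm (Fin n)) {G : SimpleGraph (Fin n) // G.edgeSet.ncard = e} where
  smul π G := ⟨G.1.comap π.symm, by
    exact (Nat.card_congr (SimpleGraph.Iso.comap π.symm G.1).mapEdgeSet).trans G.2⟩
  one_smul _ := rfl
  mul_smul _ _ _ := rfl

lemma mem_fixedBy_graphAction {e : ℕ} (π : Perm (Fin n))
    (G : {G : SimpleGraph (Fin n) // G.edgeSet.ncard = e}) :
    G ∈ MulAction.fixedBy _ π ↔ ∀ z, sym2Perm π z ∈ G.1.edgeSet ↔ z ∈ G.1.edgeSet := by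
  have hsmul (a b : Fin n) : (π • G).1.Adj a b ↔ G.1.Adj (π.symm a) (π.symm b) := Iff.rfl
  rw [MulAction.mem_fixedBy, Subtype.ext_iff]
  constructor
  · intro h z
    induction z with | _ a b
    change G.1.Adj (π a) (π b) ↔ G.1.Adj a b
    conv_lhs => rw [← h]
    rw [hsmul, symm_apply_apply, symm_apply_apply]
  · intro h
    ext a b
    rw [hsmul]
    have := h s(π.symm a, π.symm b)
    change G.1.Adj (π (π.symm a)) (π (π.symm b)) ↔ G.1.Adj (π.symm a) (π.symm b) at this
    rw [← this, apply_symm_apply, apply_symm_apply]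

lemma card_fixedBy_graphAction (n e : ℕ) (π : Perm (Fin n)) :
    Nat.card (MulAction.fixedBy {G : SimpleGraph (Fin n) // G.edgeSet.ncard = e} π) =
      #(invariantSubsets (sym2Perm π) (properPairs n) e) := by
  classical
  rw [← Fintype.card_coe, ← Nat.card_eq_fintype_card]
  have edge_card (G : SimpleGraph (Fin n)) : #G.edgeFinset = G.edgeSet.ncard := by
    rw [← SimpleGraph.coe_edgeFinset, Set.ncard_coe_finset]
  refine Nat.card_congr (Equiv.ofBijective (fun G => ⟨G.1.1.edgeFinset, ?_⟩) ⟨?_, ?_⟩)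
  · refine mem_invariantSubsets.2 ⟨⟨fun z hz => ?_, (edge_card _).trans G.1.2⟩, fun z => ?_⟩
    · rw [SimpleGraph.mem_edgeFinset] at hz
      simpa [properPairs] using G.1.1.not_isDiag_of_mem_edgeSet hz
    · rw [SimpleGraph.mem_edgeFinset, SimpleGraph.mem_edgeFinset]
      exact (mem_fixedBy_graphAction π G.1).1 G.2 z
  · intro G H h
    exact Subtype.ext (Subtype.ext (SimpleGraph.edgeFinset_inj.1 (Subtype.ext_iff.1 h)))
  · rintro ⟨S, hS⟩
    obtain ⟨⟨hSU, hSe⟩, hinv⟩ := mem_invariantSubsets.1 hS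
    obtain ⟨H, hH⟩ : ∃ H : SimpleGraph (Fin n), H.edgeSet = S := by
      refine ⟨SimpleGraph.fromEdgeSet S, ?_⟩
      rw [SimpleGraph.edgeSet_fromEdgeSet, sdiff_eq_left, Set.disjoint_left]
      exact fun z hz => (mem_filter.1 (hSU hz)).2
    refine ⟨⟨⟨H, by rw [hH, Set.ncard_coe_finset, hSe]⟩,
      (mem_fixedBy_graphAction π _).2 fun z => ?_⟩, Subtype.ext ?_⟩
    · simpa only [hH, mem_coe] using hinv z
    · ext z
      rw [SimpleGraph.mem_edgeFinset, hH, mem_coe]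

/-- Burnside's formula for the number of unlabeled graphs. -/
lemma sum_card_invariantSubsets (n e : ℕ) :
    ∑ π : Perm (Fin n), #(invariantSubsets (sym2Perm π) (properPairs n) e) =
      numGraphs n e * n.factorial := by
  classical
  have horbit : MulAction.orbitRel (Perm (Fin n)) _ =
      isoSetoid fun G : SimpleGraph (Fin n) => G.edgeSet.ncard = e := by
    ext G H
    change G ∈ MulAction.orbit _ H ↔ Nonempty (G.1 ≃g H.1)
    constructor
    · rintro ⟨π, rfl⟩
      exact ⟨SimpleGraph.Iso.comap π.symm H.1⟩
    · rintro ⟨f⟩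
      refine ⟨f.toEquiv.symm, Subtype.ext ?_⟩
      ext a b
      exact f.map_rel_iff
  have hB := MulAction.sum_card_fixedBy_eq_card_orbits_mul_card_group (Perm (Fin n))
    {G : SimpleGraph (Fin n) // G.edgeSet.ncard = e}
  simp_rw [← Nat.card_eq_fintype_card, card_fixedBy_graphAction] at hB
  rw [hB, Nat.card_perm, Nat.card_fin, numGraphs, ← horbit]

end Burnside

section LowerBound

variable {n : ℕ}

lemma card_filter_val_lt {v : ℕ} (hv : v ≤ n) :
    #(univ.filter fun i : Fin n => (i : ℕ) < v) = v := by
  have : (univ.filter fun i : Fin n => (i : ℕ) < v) =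
      (univ : Finset (Fin v)).map (Fin.castLEEmb hv) := by
    ext i
    simp only [mem_filter, mem_univ, true_and, mem_map]
    exact ⟨fun h => ⟨⟨i, h⟩, rfl⟩, fun ⟨a, ha⟩ => ha ▸ a.2⟩
  rw [this, card_map, card_fin]

/-- A permutation fixing the first `v` vertices fixes all graphs on these vertices. -/
lemma choose_le_card_invariantSubsets {v : ℕ} (hv : v ≤ n) (j : ℕ) {π : Perm (Fin n)}
    (hπ : ∀ i : Fin n, (i : ℕ) < v → π i = i) :
    (v.choose 2).choose j ≤ #(invariantSubsets (sym2Perm π) (properPairs n) j) := by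
  let A : Finset (Fin n) := univ.filter fun i => (i : ℕ) < v
  have hpairs : #(A.offDiag.image Sym2.mk.uncurry) = v.choose 2 := by
    rw [Sym2.card_image_offDiag, card_filter_val_lt hv]
  have hmem {z : Sym2 (Fin n)} (hz : z ∈ A.offDiag.image Sym2.mk.uncurry) :
      z ∈ properPairs n ∧ sym2Perm π z = z := by
    obtain ⟨⟨a, b⟩, hab, rfl⟩ := mem_image.1 hz
    simp only [A, mem_offDiag, mem_filter, mem_univ, true_and] at hab
    refine ⟨by simpa [properPairs] using hab.2.2, ?_⟩
    change s(π a, π b) = s(a, b)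
    rw [hπ a hab.1, hπ b hab.2.1]
  rw [← hpairs, ← card_powersetCard]
  refine card_le_card fun S hS => ?_
  rw [mem_powersetCard] at hS
  refine mem_invariantSubsets.2 ⟨⟨fun z hz => (hmem (hS.1 hz)).1, hS.2⟩, fun z => ⟨fun h => ?_,
    fun h => ?_⟩⟩
  · rwa [← (sym2Perm π).injective (hmem (hS.1 h)).2]
  · rwa [(hmem (hS.1 h)).2]

/-- There are at least `(n - v)!` permutations fixing the first `v` vertices. -/
lemma factorial_mul_choose_le {v : ℕ} (hv : v ≤ n) (j : ℕ) :
    (n - v).factorial * (v.choose 2).choose j ≤ numGraphs n j * n.factorial := by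
  classical
  have hcard : Fintype.card {i : Fin n // ¬ (i : ℕ) < v} = n - v := by
    rw [Fintype.card_subtype_compl, Fintype.card_fin, Fintype.card_subtype, card_filter_val_lt hv]
  have hperm : #((univ : Finset (Perm {i : Fin n // ¬ (i : ℕ) < v})).image Perm.ofSubtype) =
      (n - v).factorial := by
    rw [card_image_of_injective _ Perm.ofSubtype_injective, card_univ, Fintype.card_perm, hcard]
  rw [← sum_card_invariantSubsets, ← hperm, ← smul_eq_mul, ← sum_const]
  refine (sum_le_sum fun π hπ => ?_).trans (sum_le_sum_of_subset (subset_univ _))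
  obtain ⟨τ, -, rfl⟩ := mem_image.1 hπ
  exact choose_le_card_invariantSubsets hv j fun i hi =>
    Perm.ofSubtype_apply_of_not_mem τ (not_not.2 hi)

lemma choose_le_pow_mul_numGraphs {v : ℕ} (hv : v ≤ n) (j : ℕ) :
    (v.choose 2).choose j ≤ n ^ v * numGraphs n j := by
  refine Nat.le_of_mul_le_mul_left ?_ (n - v).factorial_pos
  refine (factorial_mul_choose_le hv j).trans ?_
  rw [← Nat.factorial_mul_descFactorial hv]
  calc numGraphs n j * ((n - v).factorial * n.descFactorial v)
      ≤ numGraphs n j * ((n - v).factorial * n ^ v) := by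
        gcongr
        exact Nat.descFactorial_le_pow n v
    _ = (n - v).factorial * (n ^ v * numGraphs n j) := by ring

/-- A lower bound for the number of graphs with `j` edges, coming from the graphs supported on
`v` vertices. -/
lemma pow_le_pow_mul_numGraphs {v j : ℕ} (hv : v ≤ n) (hj : j ≤ n) (hn : 0 < n)
    (hN : n ^ 2 ≤ 512 * (v.choose 2 + 1 - j)) :
    n ^ j ≤ 512 ^ j * n ^ v * numGraphs n j := by
  refine Nat.le_of_mul_le_mul_left ?_ (pow_pos hn j)
  calc n ^ j * n ^ j = (n ^ 2) ^ j := by ring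
    _ ≤ (512 * (v.choose 2 + 1 - j)) ^ j := by gcongr
    _ = 512 ^ j * (v.choose 2 + 1 - j) ^ j := mul_pow _ _ _
    _ ≤ 512 ^ j * (j.factorial * (v.choose 2).choose j) := by
        rw [← Nat.descFactorial_eq_factorial_mul_choose]
        gcongr
        exact Nat.pow_sub_le_descFactorial _ _
    _ ≤ 512 ^ j * (n ^ j * (n ^ v * numGraphs n j)) := by
        gcongr
        · exact (Nat.factorial_le_pow j).trans (Nat.pow_le_pow_left hj j)
        · exact choose_le_pow_mul_numGraphs hv j
    _ = n ^ j * (512 ^ j * n ^ v * numGraphs n j) := by ring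

end LowerBound

section Asymptotics

/-- Averaging the bounds for the individual permutations. -/
lemma mul_numGraphs_le {n : ℕ} (hn : 0 < n) (M e : ℕ) :
    M * numGraphs n e ≤ numGraphs n (e + 1) +
      M * (2 ^ ((M + 1) * (e + 1)) * (n ^ (e / 2) * 3 ^ n)) := by
  refine Nat.le_of_mul_le_mul_right ?_ n.factorial_pos
  rw [mul_assoc, add_mul, ← sum_card_invariantSubsets, ← sum_card_invariantSubsets, mul_sum]
  refine (sum_le_sum fun π _ => mul_card_invariantSubsets_le (sym2Perm π) (properPairs n) hn
    (card_properPairs_le n) M e).trans_eq ?_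
  rw [sum_add_distrib, sum_const, card_univ, Fintype.card_perm, Fintype.card_fin, smul_eq_mul,
    mul_comm n.factorial]

lemma numGraphs_pos {n e : ℕ} (he : e ≤ n.choose 2) : 0 < numGraphs n e :=
  pos_of_mul_pos_right ((Nat.choose_pos he).trans_le (choose_le_pow_mul_numGraphs le_rfl e))
    (Nat.zero_le _)

/-- For large `n`, the contribution of the permutations with few fixed points is negligible. -/
lemma eventually_error_le_numGraphs (M k : ℕ) : ∀ᶠ n : ℕ in Filter.atTop,
    M * (2 ^ ((M + 1) * (n / 2 + k + 1)) * (n ^ ((n / 2 + k) / 2) * 3 ^ n)) ≤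
      numGraphs n (n / 2 + k + 1) := by
  let A := 2 ^ M * (2 ^ (M + 1) * (3 * 512))
  filter_upwards [Filter.eventually_ge_atTop (A ^ 16), Filter.eventually_ge_atTop (2 * k + 2),
    Filter.eventually_ge_atTop 1000] with n hA hk hn
  have hn0 : 0 < n := by omega
  have hj : n / 2 + k + 1 ≤ n := by omega
  have hN : n ^ 2 ≤ 512 * ((n / 8).choose 2 + 1 - (n / 2 + k + 1)) := by
    have hv : 8 * (n / 8) ≤ n ∧ n ≤ 8 * (n / 8) + 7 := by omega
    have h125 : 125 ≤ n / 8 := by omega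
    have hc : n / 8 * (n / 8) ≤ 2 * (n / 8).choose 2 + n / 8 := by
      have := Nat.choose_two_right (n / 8)
      have := Nat.div_two_mul_two_of_even (Nat.even_mul_pred_self (n / 8))
      have : n / 8 * (n / 8) = n / 8 * (n / 8 - 1) + n / 8 := by
        rw [Nat.mul_sub_one, Nat.sub_add_cancel (Nat.le_mul_self _)]
      omega
    generalize n / 8 = v at *
    have hsq : n ^ 2 ≤ (8 * v + 7) ^ 2 := Nat.pow_le_pow_left hv.2 2
    have hv2 : 125 * v ≤ v * v := Nat.mul_le_mul_right v h125
    have hexp : (8 * v + 7) ^ 2 = 64 * (v * v) + 112 * v + 49 := by ring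
    omega
  have hlow := pow_le_pow_mul_numGraphs (Nat.div_le_self n 8) hj hn0 hN
  have hApow : A ^ n ≤ n ^ (n / 8) := by
    calc A ^ n ≤ A ^ (16 * (n / 8)) := Nat.pow_le_pow_right (by positivity) (by omega)
      _ = (A ^ 16) ^ (n / 8) := pow_mul _ _ _
      _ ≤ n ^ (n / 8) := Nat.pow_le_pow_left hA _
  have hM : M ≤ (2 ^ M) ^ n :=
    Nat.lt_two_pow_self.le.trans (Nat.le_self_pow hn0.ne' _)
  refine Nat.le_of_mul_le_mul_left (hlow.trans' ?_)
    (show 0 < 512 ^ (n / 2 + k + 1) * n ^ (n / 8) by positivity)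
  calc 512 ^ (n / 2 + k + 1) * n ^ (n / 8) *
        (M * (2 ^ ((M + 1) * (n / 2 + k + 1)) * (n ^ ((n / 2 + k) / 2) * 3 ^ n)))
      ≤ 512 ^ n * n ^ (n / 8) *
        ((2 ^ M) ^ n * (2 ^ ((M + 1) * n) * (n ^ ((n / 2 + k) / 2) * 3 ^ n))) := by
        gcongr <;> norm_num
    _ = A ^ n * n ^ (n / 8 + (n / 2 + k) / 2) := by
        simp only [A, mul_pow, pow_add, pow_mul]
        ring
    _ ≤ n ^ (n / 8) * n ^ (n / 8 + (n / 2 + k) / 2) := by gcongr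
    _ = n ^ (n / 8 + (n / 8 + (n / 2 + k) / 2)) := (pow_add _ _ _).symm
    _ ≤ n ^ (n / 2 + k + 1) := Nat.pow_le_pow_right hn0 (by omega)

end Asymptotics

/-- For a fixed positive integer `m` and any `k` with `0 ≤ k < m`, the ratio
`G_{n, ⌊n/2⌋ + k + 1} / G_{n, ⌊n/2⌋ + k}` tends to infinity as `n → ∞`. -/
theorem numGraphs_ratio_tendsto_atTop (m : ℕ) (hm : 0 < m) (k : ℕ) (hk : k < m) :
    Filter.Tendsto
      (fun n : ℕ => (numGraphs n (n / 2 + k + 1) : ℝ) / (numGraphs n (n / 2 + k) : ℝ))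
      Filter.atTop Filter.atTop := by
  rw [Filter.tendsto_atTop]
  intro b
  obtain ⟨M, hM⟩ := exists_nat_ge (2 * b)
  filter_upwards [eventually_error_le_numGraphs M k, Filter.eventually_ge_atTop (2 * k + 4)]
    with n herr hn
  have hpos : 0 < numGraphs n (n / 2 + k) := by
    refine numGraphs_pos ((show n / 2 + k ≤ n by omega).trans ?_)
    rw [Nat.choose_two_right, Nat.le_div_iff_mul_le two_pos]
    exact Nat.mul_le_mul_left n (by omega)
  have hle : M * numGraphs n (n / 2 + k) ≤ 2 * numGraphs n (n / 2 + k + 1) := by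
    have := mul_numGraphs_le (show 0 < n by omega) M (n / 2 + k)
    omega
  have hle' : (M : ℝ) * numGraphs n (n / 2 + k) ≤ 2 * numGraphs n (n / 2 + k + 1) := by
    exact_mod_cast hle
  have hpos' : (0 : ℝ) < numGraphs n (n / 2 + k) := by exact_mod_cast hpos
  rw [le_div_iff₀ hpos']
  nlinarith
end
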